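/- Let A be a (possibly infinite) geometrically fast set of positive bump functions in Homeo₊(I), equipped with a marking witnessing fastness. Suppose w is a nonempty word and there is s ∈ J(w) with finite history such that w is a minimal return word for s (sw = s, and no proper nonempty prefix of w is a return word for s). Then the composition w acts as the identity on all of J(w). -/

import Mathlib

open Set

/-- The unit interval `[0,1]` as a type. -/
abbrev UI : Type := ↥unitInterval

/-- Bijections of the unit interval; orientation-preserving homeomorphisms are
exactly the monotone ones among these. -/
abbrev Homeo01 : Type := Equiv.Perm UI

namespace PingPong

/-- The support of `f`. -/
def supt (f : Homeo01) : Set UI := {t | f t ≠ t}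

/-- `f` is an orientation-preserving homeomorphism of `[0,1]`:
a monotone bijection of `[0,1]` (automatically a homeomorphism). -/
def IsOPH (f : Homeo01) : Prop := Monotone ⇑f

/-- A bump function: an orientation preserving homeomorphism with exactly one
orbital, i.e. whose support is nonempty and connected. -/
def IsBump (f : Homeo01) : Prop := IsOPH f ∧ IsConnected (supt f)

/-- A positive bump function. -/
def IsPosBump (f : Homeo01) : Prop := IsBump f ∧ ∀ t ∈ supt f, t < f t

/-- The source of a positive bump `a` with marker `t`. -/
def src (a : Homeo01) (t : UI) : Set UI := {s ∈ supt a | s < t}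

/-- The destination of a positive bump `a` with marker `t`. -/
def dest (a : Homeo01) (t : UI) : Set UI := {s ∈ supt a | a t ≤ s}

/-- `m` is a marking of the collection `A` of bumps. -/
def IsMarking (A : Set Homeo01) (m : Homeo01 → UI) : Prop := ∀ a ∈ A, m a ∈ supt a

/-- The feet of a marked bump: `false` gives the source, `true` the destination. -/
def foot (a : Homeo01) (t : UI) : Bool → Set UI
  | false => src a t
  | true => dest a t

/-- The feet of the marked family `(A, m)` are pairwise disjoint. -/
def FeetDisjoint (A : Set Homeo01) (m : Homeo01 → UI) : Prop :=
  ∀ a ∈ A, ∀ b ∈ A, ∀ i j : Bool, (a, i) ≠ (b, j) →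
    Disjoint (foot a (m a) i) (foot b (m b) j)

/-- A geometrically fast collection of (positive) bumps. -/
def FastBumps (A : Set Homeo01) : Prop :=
  (∀ a ∈ A, IsPosBump a) ∧ ∃ m : Homeo01 → UI, IsMarking A m ∧ FeetDisjoint A m

/-- `t` is a left transition point of `f`. -/
def IsLeftTransition (f : Homeo01) (t : UI) : Prop :=
  t ∉ supt f ∧ ∀ ε : ℝ, 0 < ε → ∃ s ∈ supt f, t < s ∧ (s : ℝ) < (t : ℝ) + ε

/-- `t` is a right transition point of `f`. -/
def IsRightTransition (f : Homeo01) (t : UI) : Prop :=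
  t ∉ supt f ∧ ∀ ε : ℝ, 0 < ε → ∃ s ∈ supt f, s < t ∧ (t : ℝ) - ε < (s : ℝ)

/-- `t` is a transition point of `f`. -/
def IsTransition (f : Homeo01) (t : UI) : Prop :=
  IsLeftTransition f t ∨ IsRightTransition f t

/-- A geometrically proper set of homeomorphisms. -/
def GeomProper (X : Set Homeo01) : Prop :=
  (∀ f ∈ X, ∀ g ∈ X, f ≠ g → ∀ t : UI, ¬(IsLeftTransition f t ∧ IsLeftTransition g t)) ∧
  (∀ f ∈ X, ∀ g ∈ X, f ≠ g → ∀ t : UI, ¬(IsRightTransition f t ∧ IsRightTransition g t))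

/-- The positive bump `a` is used in `f`. -/
def UsedIn (f a : Homeo01) : Prop :=
  IsPosBump a ∧ (Set.EqOn ⇑f ⇑a (supt a) ∨ Set.EqOn ⇑f ⇑a⁻¹ (supt a))

/-- The set of (positive) bumps used in `X`. -/
def usedBumps (X : Set Homeo01) : Set Homeo01 := {a | ∃ f ∈ X, UsedIn f a}

/-- A geometrically fast set of homeomorphisms. -/
def GeomFast (X : Set Homeo01) : Prop := GeomProper X ∧ FastBumps (usedBumps X)

/-- The set of transition points of elements of `X`. -/
def transitionPoints (X : Set Homeo01) : Set UI := {t | ∃ f ∈ X, IsTransition f t}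

/-! ### Words -/

/-- A word in the alphabet `A^± = A ∪ A⁻¹`, recorded as a list of the permutations
represented by its symbols (for a set `A` of positive bumps this is faithful,
since `A ∩ A⁻¹ = ∅`). -/
def WordOn (A : Set Homeo01) (w : List Homeo01) : Prop := ∀ x ∈ w, x ∈ A ∨ x⁻¹ ∈ A

/-- A freely reduced word: no symbol is immediately followed by its inverse. -/
def FreelyReduced (w : List Homeo01) : Prop := List.Chain' (fun a b => b ≠ a⁻¹) w

/-- The right action of a word on a point: apply the symbols from left to right. -/
def act (t : UI) (w : List Homeo01) : UI := w.foldl (fun s a => a s) t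

/-- `w` is locally reduced at `t`. -/
def LocallyReducedAt (w : List Homeo01) (t : UI) : Prop :=
  FreelyReduced w ∧ ∀ (u : List Homeo01) (a : Homeo01), u ++ [a] <+: w → a (act t u) ≠ act t u

open Classical in
/-- The source of a symbol of `A^±`: for `a ∈ A` it is `src a`, and for the
formal inverse of an element of `A` it is the destination of that element. -/
noncomputable def symSrc (A : Set Homeo01) (m : Homeo01 → UI) (b : Homeo01) : Set UI :=
  if b ∈ A then src b (m b) else dest b⁻¹ (m b⁻¹)

open Classical in
/-- The destination of a symbol of `A^±`. -/
noncomputable def symDest (A : Set Homeo01) (m : Homeo01 → UI) (b : Homeo01) : Set UI :=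
  if b ∈ A then dest b (m b) else src b⁻¹ (m b⁻¹)

/-- The source of a word: the source of its first symbol (empty for the empty word). -/
noncomputable def wordSrc (A : Set Homeo01) (m : Homeo01 → UI) : List Homeo01 → Set UI
  | [] => ∅
  | a :: _ => symSrc A m a

/-- The destination of a word: the destination of its last symbol. -/
noncomputable def wordDest (A : Set Homeo01) (m : Homeo01 → UI) (w : List Homeo01) : Set UI :=
  match w.getLast? with
  | none => ∅
  | some a => symDest A m a

/-- `J(w) = supt(a) \ src(a)` where `a` is the first symbol of `w`. -/
noncomputable def Jset (A : Set Homeo01) (m : Homeo01 → UI) : List Homeo01 → Set UI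
  | [] => ∅
  | a :: _ => supt a \ symSrc A m a

/-- `t` has trivial history: it lies in no foot of any element of `A`. -/
def TrivialHistory (A : Set Homeo01) (m : Homeo01 → UI) (t : UI) : Prop :=
  ∀ a ∈ A, t ∉ src a (m a) ∧ t ∉ dest a (m a)

/-- `x` has finite history: there is a finite bound on the lengths of `A`-words
locally reduced at `x` whose evaluation at `x` is outside their destination. -/
def FiniteHistory (A : Set Homeo01) (m : Homeo01 → UI) (x : UI) : Prop :=
  ∃ n : ℕ, ∀ w : List Homeo01, WordOn A w → LocallyReducedAt w x →
    act x w ∉ wordDest A m w → w.length ≤ n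

/-- A return word for `x`. -/
def IsReturnWord (x : UI) (w : List Homeo01) : Prop := w ≠ [] ∧ act x w = x

/-- `w` has a return prefix for `x`. -/
def HasReturnPrefix (x : UI) (w : List Homeo01) : Prop :=
  ∃ v : List Homeo01, v <+: w ∧ IsReturnWord x v

/-- The set of initial markers of the marked family `(A, m)`. -/
def initialMarkers (A : Set Homeo01) (m : Homeo01 → UI) : Set UI :=
  {t | (∃ a ∈ A, m a = t) ∧ ∀ b ∈ A, m b < t → b (m b) ≠ t}

/-- `M⟨X⟩`: the orbit of the set of initial markers of `(A, m)` under the group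
generated by `X`. -/
def MOrbit (A : Set Homeo01) (m : Homeo01 → UI) (X : Set Homeo01) : Set UI :=
  {u | ∃ t ∈ initialMarkers A m, ∃ g ∈ Subgroup.closure X, g t = u}

end PingPong
namespace PingPong

/-! ### Piecewise linear maps and Thompson's group F -/

/-- `f` is piecewise linear (finitely many affine pieces). -/
def IsPL (f : Homeo01) : Prop :=
  ∃ (n : ℕ) (t : Fin (n + 1) → ℝ), StrictMono t ∧ t 0 = 0 ∧ t (Fin.last n) = 1 ∧
    ∀ i : Fin n, ∃ c d : ℝ, ∀ s : UI,
      t i.castSucc ≤ (s : ℝ) → (s : ℝ) ≤ t i.succ → ((f s : ℝ)) = c * (s : ℝ) + d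

/-- `x` is a dyadic rational. -/
def IsDyadic (x : ℝ) : Prop := ∃ (a : ℤ) (k : ℕ), x = (a : ℝ) / 2 ^ k

/-- `f` belongs to Thompson's group `F`: an orientation-preserving piecewise linear
homeomorphism of `[0,1]` with dyadic breakpoints and slopes integer powers of `2`. -/
def InThompsonF (f : Homeo01) : Prop :=
  IsOPH f ∧
  ∃ (n : ℕ) (t : Fin (n + 1) → ℝ), StrictMono t ∧ t 0 = 0 ∧ t (Fin.last n) = 1 ∧
    (∀ i, IsDyadic (t i)) ∧
    ∀ i : Fin n, ∃ (k : ℤ) (d : ℝ), ∀ s : UI,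
      t i.castSucc ≤ (s : ℝ) → (s : ℝ) ≤ t i.succ → ((f s : ℝ)) = (2 : ℝ) ^ k * (s : ℝ) + d

/-! ### Stretched transition chains -/

/-- `a` is isolated in `A`: its support contains no transition point of an element of `A`. -/
def IsolatedIn (A : Set Homeo01) (a : Homeo01) : Prop :=
  ∀ t ∈ supt a, ∀ b ∈ A, ¬ IsTransition b t

/-- `c` (with supports `(x i, y i)`) is a stretched transition chain of `A`. -/
def IsSTC (A : Set Homeo01) (k : ℕ) (c : Fin (k + 1) → Homeo01)
    (x y : Fin (k + 1) → ℝ) : Prop :=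
  (∀ i, c i ∈ A ∧ ¬ IsolatedIn A (c i)) ∧
  (∀ i, supt (c i) = {t : UI | x i < (t : ℝ) ∧ (t : ℝ) < y i}) ∧
  (∀ i : Fin k, x i.castSucc < x i.succ ∧ x i.succ < y i.castSucc ∧ y i.castSucc < y i.succ) ∧
  (∀ i : Fin k, ∀ t : UI, x i.succ < (t : ℝ) → (t : ℝ) < y i.castSucc →
    ∀ b ∈ A, ¬ IsTransition b t)

/-- `S` is the underlying set of some stretched transition chain of `A`. -/
def ChainSet (A : Set Homeo01) (S : Set Homeo01) : Prop :=
  ∃ (k : ℕ) (c : Fin (k + 1) → Homeo01) (x y : Fin (k + 1) → ℝ),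
    IsSTC A k c x y ∧ S = Set.range c

/-- `S` is the underlying set of a maximal stretched transition chain of `A`. -/
def MaxChainSet (A : Set Homeo01) (S : Set Homeo01) : Prop :=
  ChainSet A S ∧ ∀ S' : Set Homeo01, ChainSet A S' → S ⊆ S' → S = S'

/-- The transition points of `A` lying in the support of the chain `c`. -/
def chainTrans (A : Set Homeo01) (k : ℕ) (c : Fin (k + 1) → Homeo01) : Set UI :=
  {t | (∃ i, t ∈ supt (c i)) ∧ ∃ b ∈ A, IsTransition b t}

/-- The image of `t` under the composition `∏ C = c 0 ⋯ c k`. -/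
def chainApply (k : ℕ) (c : Fin (k + 1) → Homeo01) (t : UI) : UI :=
  (List.ofFn c).foldl (fun s a => a s) t

/-! ### Dynamical diagrams -/

/-- The collection of feet of the bumps used in `X`, with marking `m`. -/
def Feet (X : Set Homeo01) (m : Homeo01 → UI) : Set (Set UI) :=
  {S | ∃ a ∈ usedBumps X, S = src a (m a) ∨ S = dest a (m a)}

/-- The signed bumps of `f`: bumps agreeing with `f` on their support. -/
def signedBumps (f : Homeo01) : Set Homeo01 :=
  {b | IsBump b ∧ Set.EqOn ⇑b ⇑f (supt b)}

open Classical in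
/-- The source of a signed bump, with respect to the marking `m` of the positive bumps. -/
noncomputable def sSrc (m : Homeo01 → UI) (b : Homeo01) : Set UI :=
  if IsPosBump b then src b (m b) else dest b⁻¹ (m b⁻¹)

open Classical in
/-- The destination of a signed bump, with respect to the marking `m` of the positive bumps. -/
noncomputable def sDest (m : Homeo01 → UI) (b : Homeo01) : Set UI :=
  if IsPosBump b then dest b (m b) else src b⁻¹ (m b⁻¹)

/-- An isomorphism of the dynamical diagrams of the marked families `(X, mX)` and
`(Y, mY)`, inducing the bijection `τ : X → Y`: an order-preserving bijection `Φ`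
between the collections of feet, together with, for each `f ∈ X`, a bijection of the
signed bumps of `f` with those of `τ f` under which `Φ` matches sources with sources
and destinations with destinations. -/
def DiagIso (X : Set Homeo01) (mX : Homeo01 → UI) (Y : Set Homeo01) (mY : Homeo01 → UI)
    (τ : Homeo01 → Homeo01) : Prop :=
  Set.BijOn τ X Y ∧
  ∃ Φ : Set UI → Set UI,
    Set.BijOn Φ (Feet X mX) (Feet Y mY) ∧
    (∀ S ∈ Feet X mX, ∀ T ∈ Feet X mX,
      (∀ s ∈ S, ∀ t ∈ T, s < t) → ∀ s ∈ Φ S, ∀ t ∈ Φ T, s < t) ∧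
    ∀ f ∈ X, ∃ β : Homeo01 → Homeo01,
      Set.BijOn β (signedBumps f) (signedBumps (τ f)) ∧
      ∀ b ∈ signedBumps f, Φ (sSrc mX b) = sSrc mY (β b) ∧ Φ (sDest mX b) = sDest mY (β b)

/-! ### Excision -/

/-- The union of the supports of the bumps of `E` used in `f`. -/
def quotSupp (f : Homeo01) (E : Set Homeo01) : Set UI :=
  {t | ∃ a ∈ E, UsedIn f a ∧ t ∈ supt a}

/-- `g = f/E`: `g` is the identity on the supports of the bumps of `E` used in `f`,
and agrees with `f` elsewhere. -/
def IsQuot (f : Homeo01) (E : Set Homeo01) (g : Homeo01) : Prop :=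
  (∀ t ∈ quotSupp f E, g t = t) ∧ ∀ t ∉ quotSupp f E, g t = f t

/-- `E` is extraneous in `X` (with respect to the marking `m`), witnessed by an
interval `J`. -/
def Extraneous (X : Set Homeo01) (m : Homeo01 → UI) (E : Set Homeo01) : Prop :=
  ∃ J : Set UI, J.OrdConnected ∧ ∃ f ∈ X,
    (∀ e ∈ E, UsedIn f e ∧ IsolatedIn (usedBumps X) e ∧ supt e ⊆ J) ∧
    (∃ a : Homeo01, UsedIn f a ∧ a ∉ E ∧ (src a (m a) ⊆ J ∨ dest a (m a) ⊆ J)) ∧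
    ∀ g ∈ X, g ≠ f → ∀ b : Homeo01, UsedIn g b →
      Disjoint (src b (m b)) J ∧ Disjoint (dest b (m b)) J

end PingPong
namespace PingPong

/-! ### Symbols and their feet -/

theorem IsPosBump.strictMono {a : Homeo01} (h : IsPosBump a) : StrictMono a :=
  h.1.1.strictMono_of_injective a.injective

theorem IsPosBump.ordConnected_supt {a : Homeo01} (h : IsPosBump a) : (supt a).OrdConnected :=
  h.1.2.isPreconnected.ordConnected

theorem IsPosBump.not_inv {a : Homeo01} (h : IsPosBump a) : ¬ IsPosBump a⁻¹ := by
  intro h'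
  obtain ⟨t, ht⟩ := h.1.2.nonempty
  have h1 : t < a t := h.2 t ht
  have h2 : a t ∈ supt a⁻¹ := by
    simpa [supt] using h1.ne
  have h3 := h'.2 _ h2
  exact lt_asymm h1 (by simpa using h3)

theorem apply_mem_supt {a : Homeo01} {t : UI} : a t ∈ supt a ↔ t ∈ supt a := by
  simp [supt]

theorem supt_inv (a : Homeo01) : supt a⁻¹ = supt a := by
  ext t
  exact not_congr (Equiv.Perm.inv_eq_iff_eq.trans eq_comm)

theorem ordConnected_foot {a : Homeo01} (h : IsPosBump a) (t : UI) (i : Bool) :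
    (foot a t i).OrdConnected := by
  cases i
  · exact h.ordConnected_supt.inter ordConnected_Iio
  · exact h.ordConnected_supt.inter ordConnected_Ici

theorem foot_subset_supt (a : Homeo01) (t : UI) (i : Bool) : foot a t i ⊆ supt a := by
  cases i
  · exact sep_subset _ _
  · exact sep_subset _ _

/-- An order-connected set which misses both feet of a positive bump and meets its support
is contained in the support. -/
theorem subset_supt_of_disjoint_feet {a : Homeo01} (h : IsPosBump a) {t : UI} (ht : t ∈ supt a)
    {F : Set UI} (hF : F.OrdConnected) (hd : ∀ i, Disjoint F (foot a t i))
    (hne : (F ∩ supt a).Nonempty) : F ⊆ supt a := by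
  obtain ⟨z, hzF, hz⟩ := hne
  have hsrc : ∀ x ∈ F, x ∈ supt a → t ≤ x := fun x hx hxs =>
    not_lt.1 fun hlt => (Set.disjoint_left.1 (hd false)) hx ⟨hxs, hlt⟩
  have hdest : ∀ x ∈ F, x ∈ supt a → x < a t := fun x hx hxs =>
    not_le.1 fun hle => (Set.disjoint_left.1 (hd true)) hx ⟨hxs, hle⟩
  have hinv : a⁻¹ t ∈ supt a := by
    rw [← apply_mem_supt]; simpa using ht
  have hlt : a⁻¹ t < t := by simpa using h.2 _ hinv
  intro x hx
  by_contra hxs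
  have hfix : a x = x := not_not.1 hxs
  rcases lt_or_ge x t with hxt | hxt
  · have h1 : x < a⁻¹ t := by
      rw [← h.strictMono.lt_iff_lt]; simpa [hfix] using hxt
    have h2 : a⁻¹ t ∈ F := hF.out hx hzF ⟨h1.le, hlt.le.trans (hsrc z hzF hz)⟩
    exact (hsrc _ h2 hinv).not_gt hlt
  · rcases le_or_gt x (a t) with hxa | hxa
    · exact hxs (h.ordConnected_supt.out ht (apply_mem_supt.2 ht) ⟨hxt, hxa⟩)
    · have h2 : a t ∈ F := hF.out hzF hx ⟨(hdest z hzF hz).le, hxa.le⟩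
      exact (hdest _ h2 (apply_mem_supt.2 ht)).false

section Symbols

variable {A : Set Homeo01} {m : Homeo01 → UI}

theorem notMem_of_inv_mem (hA : ∀ a ∈ A, IsPosBump a) {b : Homeo01} (hb : b⁻¹ ∈ A) : b ∉ A :=
  fun h => (hA b h).not_inv (hA _ hb)

theorem symDest_inv (hA : ∀ a ∈ A, IsPosBump a) {b : Homeo01} (hb : b ∈ A ∨ b⁻¹ ∈ A) :
    symDest A m b⁻¹ = symSrc A m b := by
  rcases hb with hb | hb
  · have : b⁻¹ ∉ A := notMem_of_inv_mem hA (by simpa using hb)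
    simp [symDest, symSrc, hb, this]
  · simp [symDest, symSrc, hb, notMem_of_inv_mem hA hb]

/-- A symbol maps the complement of its source in its support into its destination. -/
theorem apply_mem_symDest (hA : ∀ a ∈ A, IsPosBump a) {b : Homeo01} (hb : b ∈ A ∨ b⁻¹ ∈ A)
    {t : UI} (ht : t ∈ supt b \ symSrc A m b) : b t ∈ symDest A m b := by
  obtain ⟨hts, htn⟩ := ht
  rcases hb with hb | hb
  · simp only [symSrc, symDest, hb, if_true] at htn ⊢
    exact ⟨apply_mem_supt.2 hts, (hA b hb).1.1 (not_lt.1 fun h => htn ⟨hts, h⟩)⟩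
  · simp only [symSrc, symDest, notMem_of_inv_mem hA hb, if_false] at htn ⊢
    have hts' : t ∈ supt b⁻¹ := by rwa [supt_inv]
    refine ⟨by rw [supt_inv]; exact apply_mem_supt.2 hts, ?_⟩
    rw [← (hA _ hb).strictMono.lt_iff_lt]
    simpa using not_le.1 fun h => htn ⟨hts', h⟩

theorem disjoint_symDest_symSrc (hfd : FeetDisjoint A m) {b c : Homeo01}
    (hb : b ∈ A ∨ b⁻¹ ∈ A) (hc : c ∈ A ∨ c⁻¹ ∈ A) (hbc : b ≠ c⁻¹) :
    Disjoint (symDest A m c) (symSrc A m b) := by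
  have hcb : c ≠ b⁻¹ := fun h => hbc (by simp [h])
  unfold symDest symSrc
  split_ifs with h1 h2 h2
  · exact hfd c h1 b h2 true false (by simp)
  · exact hfd c h1 _ (hb.resolve_left h2) true true (by simpa using hcb)
  · exact hfd _ (hc.resolve_left h1) b h2 false false (by simpa using hbc.symm)
  · exact hfd _ (hc.resolve_left h1) _ (hb.resolve_left h2) false true (by simp)

/-- If the destination of `c` meets the support of another symbol, then it is contained in that support. -/
theorem symDest_subset_supt (hA : ∀ a ∈ A, IsPosBump a) (hm : IsMarking A m)
    (hfd : FeetDisjoint A m) {b c : Homeo01} (hb : b ∈ A ∨ b⁻¹ ∈ A) (hc : c ∈ A ∨ c⁻¹ ∈ A)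
    (hne : (symDest A m c ∩ supt b).Nonempty) : symDest A m c ⊆ supt b := by
  obtain ⟨c', hc', i, hF⟩ : ∃ c' ∈ A, ∃ i, symDest A m c = foot c' (m c') i := by
    unfold symDest
    split_ifs with h
    · exact ⟨c, h, true, rfl⟩
    · exact ⟨c⁻¹, hc.resolve_left h, false, rfl⟩
  obtain ⟨d, hd, hsd⟩ : ∃ d ∈ A, supt b = supt d := by
    rcases hb with h | h
    · exact ⟨b, h, rfl⟩
    · exact ⟨b⁻¹, h, (supt_inv b).symm⟩
  rw [hF, hsd] at hne ⊢
  by_cases hcd : c' = d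
  · exact hcd ▸ foot_subset_supt c' (m c') i
  · exact subset_supt_of_disjoint_feet (hA d hd) (hm d hd) (ordConnected_foot (hA c' hc') _ i)
      (fun j => hfd c' hc' d hd i j (by simp [hcd])) hne

/-- Two consecutive symbols `c`, `b` such that `b` does not cancel `c` and moves every point of
the destination of `c`. -/
def Follows (A : Set Homeo01) (m : Homeo01 → UI) (c b : Homeo01) : Prop :=
  b ≠ c⁻¹ ∧ symDest A m c ⊆ supt b

theorem apply_mem_of_follows (hA : ∀ a ∈ A, IsPosBump a) (hfd : FeetDisjoint A m)
    {b c : Homeo01} (hb : b ∈ A ∨ b⁻¹ ∈ A) (hc : c ∈ A ∨ c⁻¹ ∈ A) (h : Follows A m c b)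
    {t : UI} (ht : t ∈ supt c \ symSrc A m c) : c t ∈ supt b \ symSrc A m b := by
  have := apply_mem_symDest hA hc ht
  exact ⟨h.2 this, Set.disjoint_left.1 (disjoint_symDest_symSrc hfd hb hc h.1) this⟩

end Symbols

/-! ### Words and chains -/

theorem act_append (t : UI) (u v : List Homeo01) : act t (u ++ v) = act (act t u) v :=
  List.foldl_append

theorem act_cons (t : UI) (a : Homeo01) (v : List Homeo01) : act t (a :: v) = act (a t) v := rfl

theorem act_inv_word (t : UI) (u : List Homeo01) :
    act (act t u) (u.map (·⁻¹)).reverse = t := by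
  induction u generalizing t with
  | nil => rfl
  | cons a u ih =>
    rw [List.map_cons, List.reverse_cons, act_append, act_cons t, ih]
    simp [act]

/-- The formal inverse of a word locally reduced at `t` is locally reduced at the image of `t`. -/
theorem LocallyReducedAt.inv {u : List Homeo01} {t : UI} (h : LocallyReducedAt u t) :
    LocallyReducedAt (u.map (·⁻¹)).reverse (act t u) := by
  refine ⟨?_, ?_⟩
  · have h1 : List.IsChain (fun a b : Homeo01 => b ≠ a⁻¹) u := h.1
    change List.IsChain (fun a b : Homeo01 => b ≠ a⁻¹) _
    rw [List.isChain_reverse, List.isChain_map]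
    refine h1.imp fun a b hab hba => hab ?_
    simpa using hba.symm
  · rintro p b ⟨q, hq⟩ hfix
    have hu : u = (q.map (·⁻¹)).reverse ++ [b⁻¹] ++ (p.map (·⁻¹)).reverse := by
      have := congrArg (fun l : List Homeo01 => (l.map (·⁻¹)).reverse) hq
      simpa [List.map_reverse] using this.symm
    have hp : p = (((p.map (·⁻¹)).reverse).map (·⁻¹)).reverse := by
      simp [List.map_reverse]
    have hact : act (act t u) p = b⁻¹ (act t (q.map (·⁻¹)).reverse) := by
      have := act_inv_word (act t ((q.map (·⁻¹)).reverse ++ [b⁻¹])) (p.map (·⁻¹)).reverse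
      rw [← hp, ← act_append t, ← hu] at this
      rw [this, act_append]
      rfl
    rw [hact] at hfix
    exact h.2 _ b⁻¹ ⟨_, hu.symm⟩ (by simpa using hfix.symm)

section Chains

variable {A : Set Homeo01} {m : Homeo01 → UI}

theorem act_mem_wordDest (hA : ∀ a ∈ A, IsPosBump a) (hfd : FeetDisjoint A m)
    {u : List Homeo01} (hu : WordOn A u) (hch : u.IsChain (Follows A m)) {t : UI}
    (ht : t ∈ Jset A m u) : act t u ∈ wordDest A m u := by
  induction u generalizing t with
  | nil => exact ht
  | cons a u ih =>
    cases u with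
    | nil => exact apply_mem_symDest hA (hu a (by simp)) ht
    | cons b u =>
      rw [List.isChain_cons_cons] at hch
      have := ih (fun x hx => hu x (List.mem_cons_of_mem _ hx)) hch.2
        (apply_mem_of_follows hA hfd (hu b (by simp)) (hu a (by simp)) hch.1 ht)
      simpa only [wordDest, List.getLast?_cons_cons, act_cons] using this

theorem locallyReducedAt_of_isChain (hA : ∀ a ∈ A, IsPosBump a) (hfd : FeetDisjoint A m)
    {u : List Homeo01} (hu : WordOn A u) (hch : u.IsChain (Follows A m)) {t : UI}
    (ht : t ∈ Jset A m u) : LocallyReducedAt u t := by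
  refine ⟨hch.imp fun a b h => h.1, fun p d hp => ?_⟩
  induction u generalizing t p with
  | nil => exact absurd ht (by simp [Jset])
  | cons a u ih =>
    cases p with
    | nil =>
      obtain rfl : d = a := by simpa using hp
      exact ht.1
    | cons a' p =>
      rw [List.cons_append, List.cons_prefix_cons] at hp
      obtain ⟨rfl, hp⟩ := hp
      cases u with
      | nil => simp at hp
      | cons b u =>
        rw [List.isChain_cons_cons] at hch
        exact ih (fun x hx => hu x (List.mem_cons_of_mem _ hx)) hch.2
          (apply_mem_of_follows hA hfd (hu b (by simp)) (hu a' (by simp)) hch.1 ht) p hp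

/-- A point of `J(u)` with finite history is not returned to itself by a chain `u`. -/
theorem act_ne_of_isChain (hA : ∀ a ∈ A, IsPosBump a) (hm : IsMarking A m)
    (hfd : FeetDisjoint A m) {a : Homeo01} {u : List Homeo01} (hu : WordOn A (a :: u))
    (hch : (a :: u).IsChain (Follows A m)) {s : UI} (hs : s ∈ Jset A m (a :: u))
    (hfin : FiniteHistory A m s) : act s (a :: u) ≠ s := by
  intro hret
  have ha : a ∈ A ∨ a⁻¹ ∈ A := hu a (by simp)
  have hlast : ∀ c ∈ (a :: u).getLast?, Follows A m c a := by
    intro c hc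
    have hcA : c ∈ A ∨ c⁻¹ ∈ A := hu c (List.mem_of_getLast? hc)
    have hsc := act_mem_wordDest hA hfd hu hch hs
    rw [hret, wordDest, Option.mem_def.1 hc] at hsc
    refine ⟨?_, symDest_subset_supt hA hm hfd ha hcA ⟨s, hsc, hs.1⟩⟩
    intro hac
    obtain rfl : c = a⁻¹ := by simp [hac]
    exact hs.2 (symDest_inv hA ha ▸ hsc)
  have hpow : ∀ n : ℕ, ∃ v : List Homeo01, n < (a :: v).length ∧ WordOn A (a :: v) ∧
      (a :: v).IsChain (Follows A m) ∧ act s (a :: v) = s := by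
    intro n
    induction n with
    | zero => exact ⟨u, by simp, hu, hch, hret⟩
    | succ n ih =>
      obtain ⟨v, hn, hv, hvch, hvret⟩ := ih
      refine ⟨u ++ a :: v, ?_, ?_, ?_, ?_⟩
      · simp only [List.length_cons, List.length_append] at hn ⊢
        omega
      · intro x hx
        rw [← List.cons_append, List.mem_append] at hx
        exact hx.elim (hu x) (hv x)
      · rw [← List.cons_append, List.isChain_append]
        refine ⟨hch, hvch, fun x hx y hy => ?_⟩
        obtain rfl : a = y := by simpa using hy
        exact hlast x hx
      · rw [← List.cons_append, act_append, hret, hvret]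
  obtain ⟨n, hn⟩ := hfin
  obtain ⟨v, hlen, hv, hvch, hvret⟩ := hpow n
  have hred := (locallyReducedAt_of_isChain hA hfd hv hvch hs).inv
  have hinv := act_inv_word s (a :: v)
  rw [hvret] at hred hinv
  refine hlen.not_ge ?_
  have := hn _ ?_ hred ?_
  · simpa using this
  · intro x hx
    obtain ⟨y, hy, rfl⟩ : ∃ y ∈ a :: v, y⁻¹ = x := by
      rw [List.mem_reverse] at hx
      exact List.mem_map.1 hx
    simpa using (hv y hy).symm
  · rw [hinv]
    have : wordDest A m ((a :: v).map (·⁻¹)).reverse = symSrc A m a := by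
      simpa [wordDest] using symDest_inv hA ha
    rw [this]
    exact hs.2

/-- A nonempty prefix of a minimal return word acts on the whole of `J(w)` either as a chain
with the same first symbol or, if it is all of `w`, as the identity. -/
theorem exists_chain_of_prefix (hA : ∀ a ∈ A, IsPosBump a) (hm : IsMarking A m)
    (hfd : FeetDisjoint A m) {a : Homeo01} {w : List Homeo01} (hw : WordOn A (a :: w)) {s : UI}
    (hs : s ∈ Jset A m (a :: w))
    (hmin : ∀ v : List Homeo01, v <+: a :: w → v ≠ [] → v ≠ a :: w → act s v ≠ s)
    (p : List Homeo01) (hp : p <+: a :: w) (hne : p ≠ []) :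
    (p = a :: w ∧ ∀ y ∈ Jset A m (a :: w), act y p = y) ∨
    ∃ u : List Homeo01, WordOn A (a :: u) ∧ (a :: u).IsChain (Follows A m) ∧
      ∀ y ∈ Jset A m (a :: w), act y (a :: u) = act y p := by
  induction p using List.reverseRecOn with
  | nil => exact absurd rfl hne
  | append_singleton p b ih =>
    have hb : b ∈ A ∨ b⁻¹ ∈ A := hw b (hp.subset (by simp))
    have ha : a ∈ A ∨ a⁻¹ ∈ A := hw a (by simp)
    rcases eq_or_ne p [] with rfl | hpne
    · obtain rfl : b = a := by simpa using hp
      exact Or.inr ⟨[], by simpa [WordOn] using ha, by simp, fun y _ => rfl⟩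
    have hpw : p ≠ a :: w := by
      rintro rfl
      simpa using hp.length_le
    obtain ⟨u, hu, hch, hact⟩ :=
      (ih ((List.prefix_append _ _).trans hp) hpne).resolve_left fun h => hpw h.1
    have hsnoc : ∀ y ∈ Jset A m (a :: w), act y (p ++ [b]) = b (act y (a :: u)) := by
      intro y hy
      rw [act_append, hact y hy]
      rfl
    obtain ⟨v, c, hvc⟩ : ∃ v c, a :: u = v ++ [c] :=
      ⟨_, _, (List.dropLast_append_getLast (List.cons_ne_nil a u)).symm⟩
    have hc : c ∈ A ∨ c⁻¹ ∈ A := hu c (by simp [hvc])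
    by_cases hbc : b = c⁻¹
    · have hcancel : ∀ y ∈ Jset A m (a :: w), act y (p ++ [b]) = act y v := by
        intro y hy
        rw [hsnoc y hy, hvc, act_append, hbc]
        simp [act]
      cases v with
      | nil =>
        refine Or.inl ⟨?_, hcancel⟩
        by_contra hpb
        exact hmin _ hp hne hpb (hcancel s hs)
      | cons a' v =>
        obtain ⟨rfl, rfl⟩ : a = a' ∧ u = v ++ [c] := by simpa using hvc
        refine Or.inr ⟨v, fun x hx => hu x ?_, ?_, fun y hy => (hcancel y hy).symm⟩
        · rw [hvc]
          exact List.mem_append_left _ hx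
        · rw [hvc] at hch
          exact hch.left_of_append
    · have hdest : ∀ y ∈ Jset A m (a :: w), act y (a :: u) ∈ symDest A m c := by
        intro y hy
        have := act_mem_wordDest hA hfd hu hch (t := y) hy
        simpa only [wordDest, hvc, List.getLast?_concat] using this
      right
      by_cases hmeet : (symDest A m c ∩ supt b).Nonempty
      · refine ⟨u ++ [b], ?_, ?_, ?_⟩
        · intro x hx
          rw [← List.cons_append, List.mem_append, List.mem_singleton] at hx
          rcases hx with hx | rfl
          · exact hu x hx
          · exact hb
        · rw [← List.cons_append, List.isChain_append]
          refine ⟨hch, by simp, fun x hx y hy => ?_⟩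
          obtain rfl : c = x := by simpa [hvc] using hx
          obtain rfl : b = y := by simpa using hy
          exact ⟨hbc, symDest_subset_supt hA hm hfd hb hc hmeet⟩
        · intro y hy
          rw [hsnoc y hy, ← List.cons_append, act_append]
          rfl
      · refine ⟨u, hu, hch, fun y hy => ?_⟩
        rw [hsnoc y hy]
        by_contra hmove
        exact hmeet ⟨_, hdest y hy, Ne.symm hmove⟩

end Chains

/-- **Lemma (FellowTraveler2).** For a geometrically fast marked set `A` of positive
bumps: if `w` is a nonempty `A`-word and some `s ∈ J(w)` with finite history has `w`
as a minimal return word, then `w` acts as the identity on all of `J(w)`. -/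
theorem minimal_return_identity (A : Set Homeo01) (m : Homeo01 → UI)
    (hA : ∀ a ∈ A, IsPosBump a) (hm : IsMarking A m) (hfd : FeetDisjoint A m)
    (w : List Homeo01) (hw : WordOn A w) (hne : w ≠ [])
    (s : UI) (hsJ : s ∈ Jset A m w) (hfin : FiniteHistory A m s)
    (hret : act s w = s)
    (hmin : ∀ v : List Homeo01, v <+: w → v ≠ [] → v ≠ w → act s v ≠ s) :
    ∀ y ∈ Jset A m w, act y w = y := by
  cases w with
  | nil => exact absurd rfl hne
  | cons a w =>
    rcases exists_chain_of_prefix hA hm hfd hw hsJ hmin _ (List.prefix_refl _) hne with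
      h | ⟨u, hu, hch, hact⟩
    · exact h.2
    · exact absurd ((hact s hsJ).trans hret) (act_ne_of_isChain hA hm hfd hu hch hsJ hfin)

end PingPong
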